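/- Let 0 < p < 1/2. There exists a constant c_p > 0, depending only on p and λ = sup_k m_k, such that for every martingale f ∈ H_p the weighted maximal operator of Fejér means satisfies ‖ sup_{n≥1} |σ_n f| / (n+1)^{1/p−2} ‖_{L_p(μ)} ≤ c_p · ‖f‖_{H_p}. -/

import Mathlib

open MeasureTheory Complex Finset
open scoped BigOperators ENNReal NNReal

noncomputable section

instance (n : ℕ) : MeasurableSpace (ZMod n) := ⊤

/-- The Vilenkin group determined by the generating sequence `m`. -/
abbrev Gm (m : ℕ → ℕ) : Type := ∀ _k : ℕ, ZMod (m _k)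

namespace Vilenkin

variable (m : ℕ → ℕ)

/-- The generalized powers `M_0 = 1`, `M_{k+1} = m_k · M_k`. -/
def M : ℕ → ℕ
  | 0 => 1
  | k + 1 => m k * M k

/-- The `j`-th digit `n_j` of `n` in the generalized number system based on `m`. -/
def digit (n j : ℕ) : ℕ := n / M m j % m j

/-- `|n|`, the index of the highest nonzero digit of `n`. -/
def hi (n : ℕ) : ℕ := Nat.findGreatest (fun j => digit m n j ≠ 0) n

/-- `⟨n⟩`, the index of the lowest nonzero digit of `n`. -/
def lo (n : ℕ) : ℕ := sInf {j | digit m n j ≠ 0}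

/-- The generalized Rademacher functions `r_k(x) = exp(2πi x_k / m_k)`. -/
def rad (k : ℕ) (x : Gm m) : ℂ :=
  Complex.exp (2 * Real.pi * Complex.I * ((x k).val : ℂ) / (m k : ℂ))

/-- The Vilenkin functions `ψ_n = ∏_k r_k^{n_k}`. -/
def vil (n : ℕ) (x : Gm m) : ℂ :=
  ∏ k ∈ Finset.range (n + 1), rad m k x ^ digit m n k

/-- The Dirichlet kernels `D_n = ∑_{k=0}^{n-1} ψ_k`. -/
def D (n : ℕ) (x : Gm m) : ℂ := ∑ k ∈ Finset.range n, vil m k x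

/-- The Fejér kernels `K_n = (1/n) ∑_{k=1}^{n} D_k`. -/
def K (n : ℕ) (x : Gm m) : ℂ := (n : ℂ)⁻¹ * ∑ k ∈ Finset.range n, D m (k + 1) x

/-- The Nörlund kernels `F_n = (1/Q_n) ∑_{k=1}^{n} q_{n-k} D_k` where
`Q_n = ∑_{k=0}^{n-1} q_k`. -/
def FK (q : ℕ → ℝ) (n : ℕ) (x : Gm m) : ℂ :=
  ((∑ k ∈ Finset.range n, q k : ℝ) : ℂ)⁻¹ *
    ∑ k ∈ Finset.range n, (q (n - (k + 1)) : ℂ) * D m (k + 1) x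

/-- The cylinder subgroup `I_n = {x : x_0 = … = x_{n-1} = 0}`. -/
def I (n : ℕ) : Set (Gm m) := {x | ∀ k < n, x k = 0}

/-- The cylinder of length `n` around `x`. -/
def cylAt (n : ℕ) (x : Gm m) : Set (Gm m) := {y | ∀ k < n, y k = x k}

/-- `μ` is the normalized Haar measure of `G_m`: the (unique) Borel probability
measure giving each cylinder of length `n` measure `1 / M_n`. -/
def IsHaar (μ : Measure (Gm m)) : Prop :=
  ∀ (n : ℕ) (x : Gm m), μ (cylAt m n x) = (M m n : ℝ≥0∞)⁻¹

/-- A martingale with respect to the filtration `(ℱ_n)` on `G_m`, where `ℱ_n` is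
generated by the first `n` coordinates: each `f n` is integrable and depends only
on the first `n` coordinates, and the conditional expectation of `f N` with
respect to `ℱ_n` (which under the Haar measure is given by averaging over the
cylinders of length `n`) equals `f n` for `n ≤ N`. -/
structure IsMartingale (μ : Measure (Gm m)) (f : ℕ → Gm m → ℂ) : Prop where
  integrable : ∀ n, Integrable (f n) μ
  adapted : ∀ (n : ℕ) (x y : Gm m), (∀ k < n, x k = y k) → f n x = f n y
  mart : ∀ n N : ℕ, n ≤ N → ∀ x : Gm m,
    f n x = (M m n : ℂ) * ∫ t in cylAt m n x, f N t ∂μ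

/-- The Vilenkin–Fourier coefficients of a martingale:
`f̂(i) = lim_k ∫ f^(k) conj(ψ_i) dμ`; for a martingale these integrals are
constant as soon as `M_k > i`, in particular from `k = i + 1` on. -/
def coeff (μ : Measure (Gm m)) (f : ℕ → Gm m → ℂ) (i : ℕ) : ℂ :=
  ∫ x, f (i + 1) x * (starRingEnd ℂ) (vil m i x) ∂μ

/-- The partial sums `S_n f = ∑_{k=0}^{n-1} f̂(k) ψ_k`. -/
def S (μ : Measure (Gm m)) (f : ℕ → Gm m → ℂ) (n : ℕ) (x : Gm m) : ℂ :=
  ∑ k ∈ Finset.range n, coeff m μ f k * vil m k x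

/-- The Fejér means `σ_n f = (1/n) ∑_{k=1}^{n} S_k f`. -/
def sigma (μ : Measure (Gm m)) (f : ℕ → Gm m → ℂ) (n : ℕ) (x : Gm m) : ℂ :=
  (n : ℂ)⁻¹ * ∑ k ∈ Finset.range n, S m μ f (k + 1) x

/-- The Nörlund means `t_n f = (1/Q_n) ∑_{k=1}^{n} q_{n-k} S_k f`. -/
def T (μ : Measure (Gm m)) (q : ℕ → ℝ) (f : ℕ → Gm m → ℂ) (n : ℕ) (x : Gm m) : ℂ :=
  ((∑ k ∈ Finset.range n, q k : ℝ) : ℂ)⁻¹ *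
    ∑ k ∈ Finset.range n, (q (n - (k + 1)) : ℂ) * S m μ f (k + 1) x

/-- The martingale maximal function `f* = sup_n |f^(n)|`. -/
def mstar (f : ℕ → Gm m → ℂ) (x : Gm m) : ℝ≥0∞ := ⨆ n, (‖f n x‖₊ : ℝ≥0∞)

/-- The `L_p`-type quasi-norm `(∫ g^p dμ)^{1/p}` of an `ℝ≥0∞`-valued function. -/
def eLp (μ : Measure (Gm m)) (p : ℝ) (g : Gm m → ℝ≥0∞) : ℝ≥0∞ :=
  (∫⁻ x, g x ^ p ∂μ) ^ (1 / p)

/-- Membership in the martingale Hardy space `H_p`: `‖f‖_{H_p} = ‖f*‖_{L_p} < ∞`. -/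
def MemHp (μ : Measure (Gm m)) (p : ℝ) (f : ℕ → Gm m → ℂ) : Prop :=
  eLp m μ p (mstar m f) ≠ ⊤

/-- The weak-`L_p` quasi-norm `sup_{t>0} t · μ(g > t)^{1/p}`. -/
def wLp (μ : Measure (Gm m)) (p : ℝ) (g : Gm m → ℝ≥0∞) : ℝ≥0∞ :=
  ⨆ t : ℝ≥0, (t : ℝ≥0∞) * μ {x | (t : ℝ≥0∞) < g x} ^ (1 / p)

end Vilenkin

namespace Vilenkin

section Kernels

variable {m : ℕ → ℕ}

lemma M_pos (hm : ∀ k, 2 ≤ m k) (n : ℕ) : 0 < M m n := by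
  induction n with
  | zero => simp [M]
  | succ n ih => exact Nat.mul_pos (by have := hm n; omega) ih

lemma two_pow_le_M (hm : ∀ k, 2 ≤ m k) (n : ℕ) : 2 ^ n ≤ M m n := by
  induction n with
  | zero => simp [M]
  | succ n ih =>
    rw [pow_succ', M]
    exact Nat.mul_le_mul (hm n) ih

lemma lt_M_self (hm : ∀ k, 2 ≤ m k) (n : ℕ) : n < M m n :=
  Nat.lt_two_pow_self.trans_le (two_pow_le_M hm n)

lemma M_dvd_M {a b : ℕ} (h : a ≤ b) : M m a ∣ M m b := by
  induction b, h using Nat.le_induction with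
  | base => exact dvd_rfl
  | succ b _ ih => exact ih.mul_left (m b)

lemma M_mono (hm : ∀ k, 2 ≤ m k) : Monotone (M m) := fun _ b h =>
  Nat.le_of_dvd (M_pos hm b) (M_dvd_M h)

lemma digit_eq_zero {n k : ℕ} (h : n < M m k) : digit m n k = 0 := by
  simp [digit, Nat.div_eq_of_lt h]

/-- The Vilenkin monomial `∏_k ρ_k ^ n_k` in the variables `ρ_k`. -/
def monomial (m : ℕ → ℕ) (ρ : ℕ → ℂ) (n : ℕ) : ℂ := ∏ k ∈ range (n + 1), ρ k ^ digit m n k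

/-- The Dirichlet kernel in the variables `ρ_k`. -/
def dirichlet (m : ℕ → ℕ) (ρ : ℕ → ℂ) (n : ℕ) : ℂ := ∑ k ∈ range n, monomial m ρ k

/-- The sum of the first `n` Dirichlet kernels in the variables `ρ_k`. -/
def fejer (m : ℕ → ℕ) (ρ : ℕ → ℂ) (n : ℕ) : ℂ := ∑ k ∈ range n, dirichlet m ρ k

open Classical in
/-- The indicator of `ρ_i = 1` for all `i < A` other than `i = t`. -/
def indic (ρ : ℕ → ℂ) (t A : ℕ) : ℝ := if ∀ i < A, i ≠ t → ρ i = 1 then 1 else 0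

lemma indic_nonneg (ρ : ℕ → ℂ) (t A : ℕ) : 0 ≤ indic ρ t A := by
  unfold indic; split_ifs <;> norm_num

variable {ρ : ℕ → ℂ}

lemma monomial_eq_prod (hm : ∀ k, 2 ≤ m k) {n K : ℕ} (h : n < M m K) :
    monomial m ρ n = ∏ k ∈ range K, ρ k ^ digit m n k := by
  have key : ∀ L, n < M m L → ∀ L', L ≤ L' →
      ∏ k ∈ range L', ρ k ^ digit m n k = ∏ k ∈ range L, ρ k ^ digit m n k := by
    intro L hL L' hLL
    symm
    apply prod_subset (range_mono hLL)
    intro k _ hk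
    rw [digit_eq_zero (hL.trans_le (M_mono hm (by simpa using hk))), pow_zero]
  have h1 : n < M m (n + 1) := (lt_M_self hm n).trans_le (M_mono hm (Nat.le_succ n))
  rw [monomial, ← key (n + 1) h1 _ (le_max_left (n + 1) K), key K h _ (le_max_right _ _)]

lemma monomial_mul_add (hm : ∀ k, 2 ≤ m k) {A j s : ℕ} (hj : j < m A) (hs : s < M m A) :
    monomial m ρ (j * M m A + s) = ρ A ^ j * monomial m ρ s := by
  have hlt : j * M m A + s < M m (A + 1) := by
    rw [M]
    nlinarith
  rw [monomial_eq_prod hm hlt, monomial_eq_prod hm hs, prod_range_succ, mul_comm]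
  congr 1
  · congr 1
    rw [digit, add_comm, Nat.add_mul_div_right _ _ (M_pos hm A), Nat.div_eq_of_lt hs, zero_add,
      Nat.mod_eq_of_lt hj]
  · apply prod_congr rfl
    intro k hk
    congr 1
    obtain ⟨d, hd⟩ : M m (k + 1) ∣ M m A := M_dvd_M (by simpa using hk)
    rw [digit, digit, hd, M]
    have : j * (m k * M m k * d) + s = s + (j * d * m k) * M m k := by ring
    rw [this, Nat.add_mul_div_right _ _ (M_pos hm k), Nat.add_mul_mod_self_right]

lemma dirichlet_mul_add (hm : ∀ k, 2 ≤ m k) {A j s : ℕ} (hj : j < m A) (hs : s ≤ M m A) :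
    dirichlet m ρ (j * M m A + s) = dirichlet m ρ (j * M m A) + ρ A ^ j * dirichlet m ρ s := by
  rw [dirichlet, sum_range_add, dirichlet, dirichlet, mul_sum]
  congr 1
  apply sum_congr rfl
  intro k hk
  exact monomial_mul_add hm hj ((mem_range.1 hk).trans_le hs)

lemma dirichlet_mul (hm : ∀ k, 2 ≤ m k) {A j : ℕ} (hj : j ≤ m A) :
    dirichlet m ρ (j * M m A) = (∑ i ∈ range j, ρ A ^ i) * dirichlet m ρ (M m A) := by
  induction j with
  | zero => simp [dirichlet]
  | succ j ih =>
    rw [Nat.succ_mul, dirichlet_mul_add hm hj le_rfl, ih (by omega), sum_range_succ, add_mul]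

lemma fejer_mul_add (hm : ∀ k, 2 ≤ m k) {A j s : ℕ} (hj : j < m A) (hs : s ≤ M m A) :
    fejer m ρ (j * M m A + s) = fejer m ρ (j * M m A) +
      s * ((∑ i ∈ range j, ρ A ^ i) * dirichlet m ρ (M m A)) + ρ A ^ j * fejer m ρ s := by
  rw [fejer, sum_range_add, fejer, fejer, mul_sum, add_assoc]
  congr 1
  rw [sum_congr rfl (fun k hk => (dirichlet_mul_add hm hj ((mem_range.1 hk).le.trans hs) :
    dirichlet m ρ (j * M m A + k) = _)), sum_add_distrib, sum_const, card_range, nsmul_eq_mul,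
    dirichlet_mul hm hj.le]

lemma fejer_mul (hm : ∀ k, 2 ≤ m k) {A j : ℕ} (hj : j ≤ m A) :
    fejer m ρ (j * M m A) =
      (∑ l ∈ range j, ∑ i ∈ range l, ρ A ^ i) * (M m A * dirichlet m ρ (M m A)) +
        (∑ i ∈ range j, ρ A ^ i) * fejer m ρ (M m A) := by
  induction j with
  | zero => simp [fejer]
  | succ j ih =>
    rw [Nat.succ_mul, fejer_mul_add hm hj le_rfl, ih (by omega), sum_range_succ _ j,
      sum_range_succ _ j]
    ring

lemma norm_geom_le {z : ℂ} (hz : ‖z‖ = 1) (j : ℕ) : ‖∑ i ∈ range j, z ^ i‖ ≤ j :=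
  (norm_sum_le _ _).trans (by simp [hz])

lemma norm_sum_geom_le {z : ℂ} (hz : ‖z‖ = 1) (j : ℕ) :
    ‖∑ l ∈ range j, ∑ i ∈ range l, z ^ i‖ ≤ (j : ℝ) * j := by
  refine (norm_sum_le _ _).trans ?_
  calc ∑ l ∈ range j, ‖∑ i ∈ range l, z ^ i‖ ≤ ∑ l ∈ range j, (j : ℝ) :=
        sum_le_sum fun l hl => (norm_geom_le hz l).trans
          (by exact_mod_cast (mem_range.1 hl).le)
    _ = (j : ℝ) * j := by simp

lemma geom_eq_zero {z : ℂ} {j : ℕ} (hz : z ^ j = 1) (h1 : z ≠ 1) : ∑ i ∈ range j, z ^ i = 0 := by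
  rw [geom_sum_eq h1, hz]; simp

lemma dirichlet_M (hm : ∀ k, 2 ≤ m k) (hρ : ∀ k, ρ k ^ m k = 1) (A : ℕ) :
    dirichlet m ρ (M m A) = (M m A * indic ρ A A : ℝ) := by
  induction A with
  | zero => simp [dirichlet, M, monomial, digit, indic]
  | succ A ih =>
    rw [M, dirichlet_mul hm le_rfl, ih]
    by_cases h : ρ A = 1
    · have : indic ρ (A + 1) (A + 1) = indic ρ A A := by
        unfold indic
        congr 1
        refine propext ⟨fun H i hi _ => H i (by omega) (by omega), fun H i hi _ => ?_⟩
        rcases Nat.lt_succ_iff_lt_or_eq.1 hi with h' | rfl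
        · exact H i h' h'.ne
        · exact h
      rw [this, h]
      push_cast
      simp
      ring
    · have : indic ρ (A + 1) (A + 1) = 0 :=
        if_neg fun H => h (H A (by omega) (by omega))
      rw [geom_eq_zero (hρ A) h, this]
      simp

lemma norm_fejer_M_le (hm : ∀ k, 2 ≤ m k) {lam : ℕ} (hlam : ∀ k, m k ≤ lam)
    (hρ : ∀ k, ρ k ^ m k = 1) (hρ1 : ∀ k, ‖ρ k‖ = 1) (A : ℕ) :
    ‖fejer m ρ (M m A)‖ ≤ (lam : ℝ) ^ 2 * ∑ t ∈ range A, M m A * M m t * indic ρ t A := by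
  induction A with
  | zero => simp [fejer, M, dirichlet]
  | succ A ih =>
    have hmA : (m A : ℝ) ≤ lam := by exact_mod_cast hlam A
    have hind : indic ρ A (A + 1) = indic ρ A A := by
      unfold indic
      congr 1
      exact propext ⟨fun H i hi h => H i (by omega) h, fun H i hi h => H i (by omega) h⟩
    have hfirst : ‖(∑ l ∈ range (m A), ∑ i ∈ range l, ρ A ^ i) *
        (M m A * dirichlet m ρ (M m A))‖ ≤
          (lam : ℝ) ^ 2 * (M m (A + 1) * M m A * indic ρ A (A + 1)) := by
      rw [norm_mul, norm_mul, dirichlet_M hm hρ, Complex.norm_real, Complex.norm_natCast,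
        Real.norm_of_nonneg (mul_nonneg (Nat.cast_nonneg _) (indic_nonneg _ _ _)), hind]
      have hMM : (M m A : ℝ) ≤ M m (A + 1) := by exact_mod_cast M_mono hm (Nat.le_succ A)
      have h0 := indic_nonneg ρ A A
      calc _ ≤ ((m A : ℝ) * m A) * (M m A * (M m A * indic ρ A A)) := by
            gcongr
            exact norm_sum_geom_le (hρ1 A) _
        _ ≤ ((lam : ℝ) * lam) * (M m (A + 1) * (M m A * indic ρ A A)) := by gcongr
        _ = _ := by ring
    have hsecond : ‖(∑ i ∈ range (m A), ρ A ^ i) * fejer m ρ (M m A)‖ ≤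
        (lam : ℝ) ^ 2 * ∑ t ∈ range A, M m (A + 1) * M m t * indic ρ t (A + 1) := by
      by_cases h : ρ A = 1
      · have : ∀ t, indic ρ t (A + 1) = indic ρ t A := by
          intro t
          unfold indic
          congr 1
          refine propext ⟨fun H i hi h => H i (by omega) h, fun H i hi h' => ?_⟩
          rcases Nat.lt_succ_iff_lt_or_eq.1 hi with h'' | rfl
          · exact H i h'' h'
          · exact h
        simp only [this]
        rw [norm_mul]
        calc _ ≤ (m A : ℝ) * ((lam : ℝ) ^ 2 * ∑ t ∈ range A, M m A * M m t * indic ρ t A) := by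
              gcongr
              exact norm_geom_le (hρ1 A) _
          _ = _ := by
              rw [mul_left_comm, mul_sum]
              congr 1
              apply sum_congr rfl
              intro t _
              rw [M]
              push_cast
              ring
      · rw [geom_eq_zero (hρ A) h, zero_mul, norm_zero]
        exact mul_nonneg (by positivity)
          (sum_nonneg fun t _ => mul_nonneg (by positivity) (indic_nonneg _ _ _))
    rw [sum_range_succ, mul_add]
    conv_lhs => rw [show M m (A + 1) = m A * M m A from rfl, fejer_mul hm le_rfl]
    exact (norm_add_le _ _).trans ((add_le_add hfirst hsecond).trans_eq (add_comm _ _))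

/-- The Fejér kernel is dominated by a positive combination of indicators. -/
lemma norm_fejer_le (hm : ∀ k, 2 ≤ m k) {lam : ℕ} (hlam : ∀ k, m k ≤ lam)
    (hρ : ∀ k, ρ k ^ m k = 1) (hρ1 : ∀ k, ‖ρ k‖ = 1) {n K : ℕ} (hn : n < M m K) :
    ‖fejer m ρ n‖ ≤ 2 * (lam : ℝ) ^ 3 *
      ∑ A ∈ range K, ∑ t ∈ range (A + 1), M m A * M m t * indic ρ t A := by
  induction K generalizing n with
  | zero =>
    obtain rfl : n = 0 := by simpa [M] using hn
    simp [fejer]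
  | succ K ih =>
    have hlam1 : (1 : ℝ) ≤ lam := by
      exact_mod_cast (show 1 ≤ lam by have := hm 0; have := hlam 0; omega)
    have hMK := M_pos hm K
    set j := n / M m K
    set s := n % M m K
    have hjs : j * M m K + s = n := Nat.div_add_mod' n (M m K)
    have hj : j < m K := Nat.div_lt_of_lt_mul (by rw [mul_comm]; exact hn)
    have hs : s < M m K := Nat.mod_lt _ hMK
    have hjl : (j : ℝ) ≤ lam := by exact_mod_cast hj.le.trans (hlam K)
    have hsM : (s : ℝ) ≤ M m K := by exact_mod_cast hs.le
    have h0 := indic_nonneg ρ K K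
    set e := indic ρ K K
    have hD : ‖dirichlet m ρ (M m K)‖ = M m K * e := by
      rw [dirichlet_M hm hρ, Complex.norm_real, Real.norm_of_nonneg (by positivity)]
    set X : ℝ := ∑ t ∈ range K, M m K * M m t * indic ρ t K
    have hX : 0 ≤ X := sum_nonneg fun t _ => mul_nonneg (by positivity) (indic_nonneg _ _ _)
    have hF := norm_fejer_M_le hm hlam hρ hρ1 K
    have h1 : ‖(∑ l ∈ range j, ∑ i ∈ range l, ρ K ^ i) * (M m K * dirichlet m ρ (M m K))‖ ≤
        lam ^ 3 * (M m K * M m K * e) := by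
      rw [norm_mul, norm_mul, hD, Complex.norm_natCast]
      calc _ ≤ ((j : ℝ) * j) * (M m K * (M m K * e)) := by
            gcongr
            exact norm_sum_geom_le (hρ1 K) _
        _ ≤ ((lam : ℝ) * lam) * (M m K * (M m K * e)) := by gcongr
        _ ≤ ((lam : ℝ) * lam * lam) * (M m K * (M m K * e)) := by
            gcongr
            exact le_mul_of_one_le_right (by positivity) hlam1
        _ = _ := by ring
    have h2 : ‖(∑ i ∈ range j, ρ K ^ i) * fejer m ρ (M m K)‖ ≤ lam ^ 3 * X := by
      rw [norm_mul]
      calc _ ≤ (lam : ℝ) * (lam ^ 2 * X) := by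
            gcongr
            exact (norm_geom_le (hρ1 K) _).trans hjl
        _ = _ := by ring
    have h3 : ‖(s : ℂ) * ((∑ i ∈ range j, ρ K ^ i) * dirichlet m ρ (M m K))‖ ≤
        lam ^ 3 * (M m K * M m K * e) := by
      rw [norm_mul, norm_mul, hD, Complex.norm_natCast]
      calc _ ≤ (M m K : ℝ) * (lam * (M m K * e)) := by
            gcongr
            exact (norm_geom_le (hρ1 K) _).trans hjl
        _ = lam * (M m K * M m K * e) := by ring
        _ ≤ _ := by
            gcongr
            exact le_self_pow₀ hlam1 (by norm_num)
    have h4 : ‖ρ K ^ j * fejer m ρ s‖ ≤ 2 * (lam : ℝ) ^ 3 *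
        ∑ A ∈ range K, ∑ t ∈ range (A + 1), M m A * M m t * indic ρ t A := by
      rw [norm_mul, norm_pow, hρ1, one_pow, one_mul]
      exact ih hs
    rw [← hjs, fejer_mul_add hm hj hs.le, fejer_mul hm hj.le, sum_range_succ, sum_range_succ _ K]
    refine (norm_add₄_le).trans ?_
    have : 0 ≤ (lam : ℝ) ^ 3 * X := by positivity
    linarith

end Kernels

section Group

variable {m : ℕ → ℕ}

lemma norm_rad (k : ℕ) (x : Gm m) : ‖rad m k x‖ = 1 := by
  have : 2 * Real.pi * Complex.I * ((x k).val : ℂ) / (m k : ℂ) =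
      ((2 * Real.pi * (x k).val / m k : ℝ) : ℂ) * Complex.I := by
    push_cast; ring
  rw [rad, this, Complex.norm_exp_ofReal_mul_I]

lemma rad_pow (hm : ∀ k, 2 ≤ m k) (k : ℕ) (x : Gm m) : rad m k x ^ m k = 1 := by
  have h0 : (m k : ℂ) ≠ 0 := by have := hm k; norm_cast; omega
  rw [rad, ← Complex.exp_nat_mul, mul_div_cancel₀ _ h0, mul_comm, Complex.exp_nat_mul_two_pi_mul_I]

lemma rad_injective (hm : ∀ k, 2 ≤ m k) {k : ℕ} {x y : Gm m} (h : rad m k x = rad m k y) :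
    x k = y k := by
  have : NeZero (m k) := ⟨by have := hm k; omega⟩
  have key : ∀ z : Gm m, rad m k z = Complex.exp (2 * Real.pi * Complex.I / m k) ^ (z k).val := by
    intro z
    rw [rad, ← Complex.exp_nat_mul]
    congr 1
    ring
  rw [key, key] at h
  exact ZMod.val_injective _ ((Complex.isPrimitiveRoot_exp (m k) (NeZero.ne _)).pow_inj
    (ZMod.val_lt _) (ZMod.val_lt _) h)

/-- The variables `r_k(x - y)`. -/
def radDiff (m : ℕ → ℕ) (x y : Gm m) (k : ℕ) : ℂ := rad m k x * (starRingEnd ℂ) (rad m k y)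

lemma norm_radDiff (x y : Gm m) (k : ℕ) : ‖radDiff m x y k‖ = 1 := by
  simp [radDiff, norm_rad]

lemma radDiff_pow (hm : ∀ k, 2 ≤ m k) (x y : Gm m) (k : ℕ) : radDiff m x y k ^ m k = 1 := by
  rw [radDiff, mul_pow, ← map_pow, rad_pow hm, rad_pow hm]; simp

lemma eq_of_radDiff_eq_one (hm : ∀ k, 2 ≤ m k) {x y : Gm m} {k : ℕ} (h : radDiff m x y k = 1) :
    y k = x k := by
  apply rad_injective hm
  have h1 : (starRingEnd ℂ) (rad m k y) * rad m k y = 1 := by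
    rw [← Complex.normSq_eq_conj_mul_self, Complex.normSq_eq_norm_sq, norm_rad]; simp
  calc rad m k y = radDiff m x y k * rad m k y := by rw [h, one_mul]
    _ = rad m k x := by rw [radDiff, mul_assoc, h1, mul_one]

lemma monomial_radDiff (x y : Gm m) (n : ℕ) :
    monomial m (radDiff m x y) n = vil m n x * (starRingEnd ℂ) (vil m n y) := by
  simp only [monomial, radDiff, vil, map_prod, map_pow, mul_pow, prod_mul_distrib]

lemma norm_vil (n : ℕ) (x : Gm m) : ‖vil m n x‖ = 1 := by
  simp [vil, norm_prod, norm_rad]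

lemma measurable_rad (k : ℕ) : Measurable (rad m k) :=
  (measurable_from_top (f := fun z : ZMod (m k) =>
    Complex.exp (2 * Real.pi * Complex.I * (z.val : ℂ) / (m k : ℂ)))).comp (measurable_pi_apply k)

lemma measurable_vil (n : ℕ) : Measurable (vil m n) :=
  Finset.measurable_fun_prod _ fun k _ => (measurable_rad k).pow_const _

lemma vil_congr {i n : ℕ} (hm : ∀ k, 2 ≤ m k) (hi : i < M m n) {x y : Gm m}
    (h : ∀ k < n, x k = y k) : vil m i x = vil m i y := by
  have key : ∀ z : Gm m, vil m i z = ∏ k ∈ range n, rad m k z ^ digit m i k := fun z =>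
    monomial_eq_prod (ρ := fun k => rad m k z) hm hi
  rw [key, key]
  apply prod_congr rfl
  intro k hk
  rw [rad, rad, h k (mem_range.1 hk)]

/-- The points agreeing with `x` in all the first `A` coordinates other than the `t`-th. -/
def cylExcept (m : ℕ → ℕ) (t A : ℕ) (x : Gm m) : Set (Gm m) := {y | ∀ k < A, k ≠ t → y k = x k}

lemma indic_radDiff_le (hm : ∀ k, 2 ≤ m k) (t A : ℕ) (x y : Gm m) :
    indic (radDiff m x y) t A ≤ (cylExcept m t A x).indicator (fun _ => 1) y := by
  unfold indic
  split_ifs with h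
  · rw [Set.indicator_of_mem]
    exact fun k hk hkt => eq_of_radDiff_eq_one hm (h k hk hkt)
  · exact Set.indicator_nonneg (fun _ _ => zero_le_one) _

lemma measurableSet_coord_eq (hm : ∀ k, 2 ≤ m k) (k : ℕ) :
    MeasurableSet {z : Gm m × Gm m | z.2 k = z.1 k} := by
  have : NeZero (m k) := ⟨by have := hm k; omega⟩
  have h2 : Measurable fun z : Gm m × Gm m => z.2 k := (measurable_pi_apply k).comp measurable_snd
  have h1 : Measurable fun z : Gm m × Gm m => z.1 k := (measurable_pi_apply k).comp measurable_fst
  have : {z : Gm m × Gm m | z.2 k = z.1 k} = ⋃ c : ZMod (m k),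
      (fun z : Gm m × Gm m => z.2 k) ⁻¹' {c} ∩ (fun z : Gm m × Gm m => z.1 k) ⁻¹' {c} := by
    ext z; simp [eq_comm]
  rw [this]
  exact MeasurableSet.iUnion fun c => (h2 trivial).inter (h1 trivial)

lemma measurableSet_cylExcept_prod (hm : ∀ k, 2 ≤ m k) (t A : ℕ) :
    MeasurableSet {z : Gm m × Gm m | z.2 ∈ cylExcept m t A z.1} := by
  have : {z : Gm m × Gm m | z.2 ∈ cylExcept m t A z.1} =
      ⋂ k : ℕ, ⋂ (_ : k < A), ⋂ (_ : k ≠ t), {z : Gm m × Gm m | z.2 k = z.1 k} := by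
    ext z; simp [cylExcept]
  rw [this]
  exact MeasurableSet.iInter fun k => MeasurableSet.iInter fun _ => MeasurableSet.iInter fun _ =>
    measurableSet_coord_eq hm k

lemma measurableSet_cylExcept (hm : ∀ k, 2 ≤ m k) (t A : ℕ) (x : Gm m) :
    MeasurableSet (cylExcept m t A x) :=
  measurable_prodMk_left (x := x) (measurableSet_cylExcept_prod hm t A)

lemma cylExcept_self (A : ℕ) (x : Gm m) : cylExcept m A A x = cylAt m A x := by
  ext y
  exact ⟨fun h k hk => h k hk hk.ne, fun h k hk _ => h k hk⟩

lemma mem_cylExcept_comm {t A : ℕ} {x y : Gm m} : y ∈ cylExcept m t A x ↔ x ∈ cylExcept m t A y :=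
  ⟨fun h k hk hkt => (h k hk hkt).symm, fun h k hk hkt => (h k hk hkt).symm⟩

variable {μ : Measure (Gm m)}

lemma IsHaar.isProbabilityMeasure (hμ : IsHaar m μ) : IsProbabilityMeasure μ := by
  constructor
  have := hμ 0 (fun _ => 0)
  simpa [cylAt, M] using this

lemma measure_cylExcept_le (hm : ∀ k, 2 ≤ m k) {lam : ℕ} (hlam : ∀ k, m k ≤ lam)
    (hμ : IsHaar m μ) (t A : ℕ) (x : Gm m) :
    μ (cylExcept m t A x) ≤ lam * (M m A : ℝ≥0∞)⁻¹ := by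
  have : NeZero (m t) := ⟨by have := hm t; omega⟩
  have hsub : cylExcept m t A x ⊆
      ⋃ c ∈ (Finset.univ : Finset (ZMod (m t))), cylAt m A (Function.update x t c) := by
    intro y hy
    simp only [Finset.mem_univ, Set.iUnion_true, Set.mem_iUnion]
    refine ⟨y t, fun k hk => ?_⟩
    by_cases h : k = t
    · subst h; simp
    · rw [Function.update_of_ne h]; exact hy k hk h
  calc μ (cylExcept m t A x) ≤ ∑ c : ZMod (m t), μ (cylAt m A (Function.update x t c)) :=
        (measure_mono hsub).trans (measure_biUnion_finset_le _ _)
    _ = m t * (M m A : ℝ≥0∞)⁻¹ := by simp [hμ A, ZMod.card]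
    _ ≤ _ := by gcongr; exact_mod_cast hlam t

/-- Integrating a martingale against a function of the first `n` coordinates only sees `f n`. -/
lemma integral_mul_eq (hm : ∀ k, 2 ≤ m k) (hμ : IsHaar m μ) {f : ℕ → Gm m → ℂ}
    (hf : IsMartingale m μ f) {n N : ℕ} (hnN : n ≤ N) {g : Gm m → ℂ} (hg : Measurable g)
    (hg1 : ∀ x, ‖g x‖ ≤ 1) (hgn : ∀ x y : Gm m, (∀ k < n, x k = y k) → g x = g y) :
    ∫ x, f n x * g x ∂μ = ∫ x, f N x * g x ∂μ := by
  have := hμ.isProbabilityMeasure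
  have hM0 : (M m n : ℂ) ≠ 0 := by exact_mod_cast (M_pos hm n).ne'
  have hint : Integrable (fun x => f N x * g x) μ :=
    (hf.integrable N).mul_bdd (c := 1) hg.aestronglyMeasurable (Filter.Eventually.of_forall hg1)
  have hmeas : ∀ x, MeasurableSet (cylAt m n x) := fun x =>
    cylExcept_self n x ▸ measurableSet_cylExcept hm n n x
  have hE := measurableSet_cylExcept_prod hm n n
  have hprod : Integrable (Function.uncurry fun x t =>
      (cylAt m n x).indicator (fun t => f N t * g t) t) (μ.prod μ) := by
    refine ((hint.comp_snd μ).indicator hE).congr (Filter.Eventually.of_forall fun z => ?_)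
    simp only [Function.uncurry, ← cylExcept_self]
    rfl
  have hL : ∀ x, f n x * g x =
      M m n * ∫ t, (cylAt m n x).indicator (fun t => f N t * g t) t ∂μ := by
    intro x
    rw [integral_indicator (hmeas x), hf.mart n N hnN x, mul_assoc, ← integral_mul_const]
    congr 1
    apply setIntegral_congr_fun (hmeas x)
    intro t ht
    simp only
    rw [hgn x t fun k hk => (ht k hk).symm]
  have hR : ∀ t, ∫ x, (cylAt m n x).indicator (fun t => f N t * g t) t ∂μ =
      (M m n : ℂ)⁻¹ * (f N t * g t) := by
    intro t
    have : (fun x => (cylAt m n x).indicator (fun t => f N t * g t) t) =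
        (cylAt m n t).indicator fun _ => f N t * g t := by
      ext x
      have : t ∈ cylAt m n x ↔ x ∈ cylAt m n t := by
        rw [← cylExcept_self, ← cylExcept_self]; exact mem_cylExcept_comm
      by_cases h : t ∈ cylAt m n x
      · rw [Set.indicator_of_mem h, Set.indicator_of_mem (this.1 h)]
      · rw [Set.indicator_of_notMem h, Set.indicator_of_notMem (fun h' => h (this.2 h'))]
    rw [this, integral_indicator_const _ (hmeas t), Measure.real, hμ n t]
    simp
  simp_rw [hL]
  rw [integral_const_mul, integral_integral_swap hprod]
  simp_rw [hR]
  rw [integral_const_mul, mul_inv_cancel_left₀ hM0]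

lemma coeff_eq (hm : ∀ k, 2 ≤ m k) (hμ : IsHaar m μ) {f : ℕ → Gm m → ℂ}
    (hf : IsMartingale m μ f) {i L : ℕ} (hi : i < M m L) :
    coeff m μ f i = ∫ x, f L x * (starRingEnd ℂ) (vil m i x) ∂μ := by
  have hmeas : Measurable fun x => (starRingEnd ℂ) (vil m i x) :=
    Complex.continuous_conj.measurable.comp (measurable_vil i)
  have hi' : i < M m (i + 1) := (Nat.lt_succ_self i).trans (lt_M_self hm (i + 1))
  have hbd : ∀ x : Gm m, ‖(starRingEnd ℂ) (vil m i x)‖ ≤ 1 := fun x => by simp [norm_vil]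
  rw [coeff]
  rcases le_total (i + 1) L with h | h
  · exact integral_mul_eq hm hμ hf h hmeas hbd fun x y hxy => by rw [vil_congr hm hi' hxy]
  · exact (integral_mul_eq hm hμ hf h hmeas hbd fun x y hxy => by rw [vil_congr hm hi hxy]).symm

lemma sigma_eq (hm : ∀ k, 2 ≤ m k) (hμ : IsHaar m μ) {f : ℕ → Gm m → ℂ}
    (hf : IsMartingale m μ f) {n L : ℕ} (hn : n < M m L) (x : Gm m) :
    sigma m μ f n x = (n : ℂ)⁻¹ * ∫ y, f L y * fejer m (radDiff m x y) (n + 1) ∂μ := by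
  have hterm : ∀ i, Integrable (fun y => f L y * monomial m (radDiff m x y) i) μ := by
    intro i
    simp_rw [monomial_radDiff]
    refine (hf.integrable L).mul_bdd (c := 1) ?_ (Filter.Eventually.of_forall fun y => ?_)
    · exact (measurable_const.mul
        (Complex.continuous_conj.measurable.comp (measurable_vil i))).aestronglyMeasurable
    · simp [norm_vil]
  rw [sigma]
  congr 1
  simp_rw [fejer, dirichlet, mul_sum]
  simp_rw [sum_range_succ' _ n]
  simp only [range_zero, sum_empty, add_zero]
  rw [integral_finsetSum _ fun k _ => integrable_finsetSum _ fun i _ => hterm i]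
  apply sum_congr rfl
  intro k hk
  rw [integral_finsetSum _ fun i _ => hterm i, S]
  apply sum_congr rfl
  intro i hi
  have hiL : i < M m L := by
    have := mem_range.1 hk; have := mem_range.1 hi; omega
  rw [coeff_eq hm hμ hf hiL, ← integral_mul_const]
  congr 1
  ext y
  rw [monomial_radDiff]
  ring

end Group

section Estimates

variable {m : ℕ → ℕ} {μ : Measure (Gm m)}

/-- On functions of the first `L` coordinates the `L_1` norm is controlled by the `L_p` one. -/
lemma lintegral_cylExcept_le (hm : ∀ k, 2 ≤ m k) (hμ : IsHaar m μ) {f : ℕ → Gm m → ℂ}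
    (hf : IsMartingale m μ f) {p : ℝ} (hp0 : 0 < p) (hp1 : p ≤ 1) {t A L : ℕ} (hAL : A ≤ L)
    (x : Gm m) :
    ∫⁻ y in cylExcept m t A x, ‖f L y‖ₑ ∂μ ≤
      (M m L : ℝ≥0∞) ^ (1 / p - 1) *
        (∫⁻ y in cylExcept m t A x, ‖f L y‖ₑ ^ p ∂μ) ^ (1 / p) := by
  set E := cylExcept m t A x
  set B := ∫⁻ y in E, ‖f L y‖ₑ ^ p ∂μ
  have hq : 0 ≤ 1 / p - 1 := by
    have := one_le_one_div hp0 hp1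
    linarith
  have hM0 : (M m L : ℝ≥0∞) ≠ 0 := by exact_mod_cast (M_pos hm L).ne'
  have hMt : (M m L : ℝ≥0∞) ≠ ⊤ := ENNReal.natCast_ne_top _
  have hpt : ∀ y ∈ E, ‖f L y‖ₑ ^ p ≤ M m L * B := by
    intro y hy
    have hsub : cylAt m L y ⊆ E := fun z hz k hk hkt =>
      (hz k (hk.trans_le hAL)).trans (hy k hk hkt)
    have hmeas : MeasurableSet (cylAt m L y) :=
      cylExcept_self L y ▸ measurableSet_cylExcept hm L L y
    have h1 : ‖f L y‖ₑ ^ p * (M m L : ℝ≥0∞)⁻¹ ≤ B := by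
      calc ‖f L y‖ₑ ^ p * (M m L : ℝ≥0∞)⁻¹ = ∫⁻ _ in cylAt m L y, ‖f L y‖ₑ ^ p ∂μ := by
            rw [setLIntegral_const, hμ L y]
        _ = ∫⁻ z in cylAt m L y, ‖f L z‖ₑ ^ p ∂μ :=
            setLIntegral_congr_fun hmeas fun z hz => by
              simp only [hf.adapted L z y hz]
        _ ≤ B := lintegral_mono_set hsub
    rwa [← div_eq_mul_inv, ENNReal.div_le_iff hM0 hMt, mul_comm] at h1
  have hpt' : ∀ y ∈ E, ‖f L y‖ₑ ≤ ‖f L y‖ₑ ^ p * (M m L * B) ^ (1 / p - 1) := by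
    intro y hy
    calc ‖f L y‖ₑ = ‖f L y‖ₑ ^ p * (‖f L y‖ₑ ^ p) ^ (1 / p - 1) := by
          rw [← ENNReal.rpow_mul, ← ENNReal.rpow_add_of_nonneg]
          · have : p + p * (1 / p - 1) = 1 := by field_simp; ring
            rw [this, ENNReal.rpow_one]
          · exact hp0.le
          · positivity
      _ ≤ _ := by gcongr; exact hpt y hy
  calc ∫⁻ y in E, ‖f L y‖ₑ ∂μ ≤ ∫⁻ y in E, ‖f L y‖ₑ ^ p * (M m L * B) ^ (1 / p - 1) ∂μ :=
        setLIntegral_mono' (measurableSet_cylExcept hm t A x) hpt'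
    _ = B * (M m L * B) ^ (1 / p - 1) :=
        lintegral_mul_const'' _ (((hf.integrable L).aemeasurable.enorm.pow_const p).restrict)
    _ = (M m L : ℝ≥0∞) ^ (1 / p - 1) * B ^ (1 / p) := by
        rw [ENNReal.mul_rpow_of_nonneg _ _ hq, mul_left_comm]
        congr 1
        have : 1 / p = 1 + (1 / p - 1) := by ring
        conv_rhs => rw [this, ENNReal.rpow_add_of_nonneg _ _ zero_le_one hq, ENNReal.rpow_one]

lemma enorm_fejer_le (hm : ∀ k, 2 ≤ m k) {lam : ℕ} (hlam : ∀ k, m k ≤ lam) {n L : ℕ}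
    (hn : n < M m L) (x y : Gm m) :
    ‖fejer m (radDiff m x y) n‖ₑ ≤ ∑ A ∈ range L, ∑ t ∈ range (A + 1),
      (cylExcept m t A x).indicator (fun _ => 2 * (lam : ℝ≥0∞) ^ 3 * (M m A * M m t)) y := by
  have h := norm_fejer_le hm hlam (radDiff_pow hm x y) (norm_radDiff x y) hn
  have hconv : ∀ A t, ENNReal.ofReal (2 * (lam : ℝ) ^ 3 * (M m A * M m t *
      (cylExcept m t A x).indicator (fun _ => 1) y)) =
      (cylExcept m t A x).indicator (fun _ => 2 * (lam : ℝ≥0∞) ^ 3 * (M m A * M m t)) y := by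
    intro A t
    by_cases hy : y ∈ cylExcept m t A x
    · rw [Set.indicator_of_mem hy, Set.indicator_of_mem hy, mul_one,
        ENNReal.ofReal_mul (by positivity), ENNReal.ofReal_mul (by positivity),
        ENNReal.ofReal_mul (by positivity), ENNReal.ofReal_pow (by positivity)]
      simp
    · simp [Set.indicator_of_notMem hy]
  have hnn : ∀ A t, (0 : ℝ) ≤ 2 * (lam : ℝ) ^ 3 * (M m A * M m t *
      (cylExcept m t A x).indicator (fun _ => 1) y) := fun A t =>
    mul_nonneg (by positivity) (mul_nonneg (by positivity)
      (Set.indicator_nonneg (fun _ _ => zero_le_one) _))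
  simp_rw [← hconv]
  rw [← ofReal_norm]
  simp_rw [← ENNReal.ofReal_sum_of_nonneg fun t _ => hnn _ t]
  rw [← ENNReal.ofReal_sum_of_nonneg fun A _ => sum_nonneg fun t _ => hnn A t]
  apply ENNReal.ofReal_le_ofReal
  refine h.trans ?_
  rw [mul_sum]
  simp_rw [mul_sum]
  gcongr with A _ t _
  exact indic_radDiff_le hm t A x y

/-- The local `L_p` mass of the maximal function near `x`. -/
def localMass (m : ℕ → ℕ) (μ : Measure (Gm m)) (p : ℝ) (u : Gm m → ℝ≥0∞) (t A : ℕ) (x : Gm m) :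
    ℝ≥0∞ := ∫⁻ y in cylExcept m t A x, u y ^ p ∂μ

lemma enorm_sigma_le (hm : ∀ k, 2 ≤ m k) {lam : ℕ} (hlam : ∀ k, m k ≤ lam) (hμ : IsHaar m μ)
    {f : ℕ → Gm m → ℂ} (hf : IsMartingale m μ f) {p : ℝ} (hp0 : 0 < p) (hp1 : p ≤ 1) {n L : ℕ}
    (hn : n + 1 < M m L) (x : Gm m) :
    ‖sigma m μ f n x‖ₑ ≤ (n : ℝ≥0∞)⁻¹ * (2 * (lam : ℝ≥0∞) ^ 3 * (M m L : ℝ≥0∞) ^ (1 / p - 1) *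
      ∑ A ∈ range L, ∑ t ∈ range (A + 1),
        M m A * M m t * localMass m μ p (mstar m f) t A x ^ (1 / p)) := by
  rw [sigma_eq hm hμ hf (n := n) (L := L) (by omega) x, enorm_mul]
  have hinv : ‖(n : ℂ)⁻¹‖ₑ ≤ (n : ℝ≥0∞)⁻¹ := by
    rcases Nat.eq_zero_or_pos n with rfl | h
    · simp
    · rw [enorm_inv (by exact_mod_cast h.ne')]
      simp [enorm_eq_nnnorm]
  refine mul_le_mul' hinv ?_
  have hfm : AEMeasurable (fun y => ‖f L y‖ₑ) μ := (hf.integrable L).aemeasurable.enorm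
  have hind : ∀ A t, AEMeasurable (fun y => ‖f L y‖ₑ * (cylExcept m t A x).indicator
      (fun _ => 2 * (lam : ℝ≥0∞) ^ 3 * (M m A * M m t)) y) μ := fun A t =>
    hfm.mul (measurable_const.indicator (measurableSet_cylExcept hm t A x)).aemeasurable
  calc ‖∫ y, f L y * fejer m (radDiff m x y) (n + 1) ∂μ‖ₑ
      ≤ ∫⁻ y, ‖f L y * fejer m (radDiff m x y) (n + 1)‖ₑ ∂μ := enorm_integral_le_lintegral_enorm _
    _ ≤ ∫⁻ y, ∑ A ∈ range L, ∑ t ∈ range (A + 1), ‖f L y‖ₑ * (cylExcept m t A x).indicator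
          (fun _ => 2 * (lam : ℝ≥0∞) ^ 3 * (M m A * M m t)) y ∂μ := by
        refine lintegral_mono fun y => ?_
        simp_rw [← mul_sum]
        rw [enorm_mul]
        gcongr
        exact enorm_fejer_le hm hlam hn x y
    _ = ∑ A ∈ range L, ∑ t ∈ range (A + 1), 2 * (lam : ℝ≥0∞) ^ 3 * (M m A * M m t) *
          ∫⁻ y in cylExcept m t A x, ‖f L y‖ₑ ∂μ := by
        rw [lintegral_finsetSum' _ fun A _ => Finset.aemeasurable_fun_sum _ fun t _ => hind A t]
        refine sum_congr rfl fun A _ => ?_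
        rw [lintegral_finsetSum' _ fun t _ => hind A t]
        refine sum_congr rfl fun t _ => ?_
        rw [← lintegral_const_mul'' _ hfm.restrict,
          ← lintegral_indicator (measurableSet_cylExcept hm t A x)]
        refine lintegral_congr fun y => ?_
        by_cases hy : y ∈ cylExcept m t A x
        · rw [Set.indicator_of_mem hy, Set.indicator_of_mem hy, mul_comm]
        · rw [Set.indicator_of_notMem hy, Set.indicator_of_notMem hy, mul_zero]
    _ ≤ ∑ A ∈ range L, ∑ t ∈ range (A + 1), 2 * (lam : ℝ≥0∞) ^ 3 * (M m A * M m t) *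
          ((M m L : ℝ≥0∞) ^ (1 / p - 1) * localMass m μ p (mstar m f) t A x ^ (1 / p)) := by
        refine sum_le_sum fun A hA => sum_le_sum fun t _ => mul_le_mul' le_rfl ?_
        refine (lintegral_cylExcept_le hm hμ hf hp0 hp1 (mem_range.1 hA).le x).trans ?_
        refine mul_le_mul' le_rfl (ENNReal.rpow_le_rpow ?_ (by positivity))
        refine lintegral_mono fun y => ENNReal.rpow_le_rpow ?_ hp0.le
        exact le_iSup (fun n => (‖f n y‖₊ : ℝ≥0∞)) L
    _ = _ := by
        simp_rw [mul_sum]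
        refine sum_congr rfl fun A _ => sum_congr rfl fun t _ => ?_
        ring

lemma exists_level (hm : ∀ k, 2 ≤ m k) {lam : ℕ} (hlam : ∀ k, m k ≤ lam) {n : ℕ} (hn : 1 ≤ n) :
    ∃ L, n < M m L ∧ M m L ≤ lam * n := by
  have hex : ∃ L, n < M m L := ⟨n, lt_M_self hm n⟩
  refine ⟨Nat.find hex, Nat.find_spec hex, ?_⟩
  obtain ⟨N, hN⟩ : ∃ N, Nat.find hex = N + 1 := by
    refine Nat.exists_eq_succ_of_ne_zero fun h => ?_
    have := Nat.find_spec hex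
    rw [h] at this
    simp only [M] at this
    omega
  have := Nat.find_min hex (m := N) (by omega)
  rw [hN, M]
  exact Nat.mul_le_mul (hlam N) (not_lt.1 this)

lemma weighted_sigma_le (hm : ∀ k, 2 ≤ m k) {lam : ℕ} (hlam : ∀ k, m k ≤ lam) (hμ : IsHaar m μ)
    {f : ℕ → Gm m → ℂ} (hf : IsMartingale m μ f) {p : ℝ} (hp0 : 0 < p) (hp1 : p < 1 / 2) (n : ℕ)
    (x : Gm m) :
    ((‖sigma m μ f (n + 1) x‖₊ : ℝ≥0∞) / ((n + 2 : ℕ) : ℝ≥0∞) ^ (1 / p - 2)) ^ p ≤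
      (4 * (lam : ℝ≥0∞) ^ 3 * (lam : ℝ≥0∞) ^ (1 / p - 1)) ^ p *
        ∑' A, ∑ t ∈ range (A + 1),
          (M m A : ℝ≥0∞) ^ p * (M m t : ℝ≥0∞) ^ p * localMass m μ p (mstar m f) t A x := by
  obtain ⟨L, hL, hLl⟩ := exists_level hm hlam (n := n + 2) (by omega)
  have hq : 0 ≤ 1 / p - 2 := by
    have := one_div_le_one_div_of_le hp0 hp1.le
    norm_num at this ⊢
    linarith
  have hs := enorm_sigma_le hm hlam hμ hf hp0 (by linarith) (n := n + 1) hL x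
  set Z := ∑ A ∈ range L, ∑ t ∈ range (A + 1),
    (M m A * M m t * localMass m μ p (mstar m f) t A x ^ (1 / p) : ℝ≥0∞)
  set w : ℝ≥0∞ := ((n + 2 : ℕ) : ℝ≥0∞)
  have hw0 : w ≠ 0 := by simp [w]
  have hwt : w ≠ ⊤ := ENNReal.natCast_ne_top _
  have hMw : (M m L : ℝ≥0∞) ^ (1 / p - 1) ≤ (lam : ℝ≥0∞) ^ (1 / p - 1) * (w * w ^ (1 / p - 2)) := by
    calc (M m L : ℝ≥0∞) ^ (1 / p - 1) ≤ (lam * w) ^ (1 / p - 1) := by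
          refine ENNReal.rpow_le_rpow ?_ (by linarith)
          simp only [w]
          exact_mod_cast hLl
      _ = _ := by
          rw [ENNReal.mul_rpow_of_nonneg _ _ (by linarith)]
          congr 1
          have : 1 / p - 1 = 1 + (1 / p - 2) := by ring
          rw [this, ENNReal.rpow_add_of_nonneg _ _ zero_le_one hq, ENNReal.rpow_one]
  have hnw : ((n + 1 : ℕ) : ℝ≥0∞)⁻¹ * w ≤ 2 := by
    rw [mul_comm, ← div_eq_mul_inv]
    refine ENNReal.div_le_of_le_mul ?_
    simp only [w]
    norm_cast
    omega
  have hdiv : (‖sigma m μ f (n + 1) x‖₊ : ℝ≥0∞) / w ^ (1 / p - 2) ≤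
      4 * (lam : ℝ≥0∞) ^ 3 * (lam : ℝ≥0∞) ^ (1 / p - 1) * Z := by
    refine ENNReal.div_le_of_le_mul (hs.trans ?_)
    calc ((n + 1 : ℕ) : ℝ≥0∞)⁻¹ * (2 * (lam : ℝ≥0∞) ^ 3 * (M m L : ℝ≥0∞) ^ (1 / p - 1) * Z)
        ≤ ((n + 1 : ℕ) : ℝ≥0∞)⁻¹ * (2 * (lam : ℝ≥0∞) ^ 3 *
            ((lam : ℝ≥0∞) ^ (1 / p - 1) * (w * w ^ (1 / p - 2))) * Z) := by gcongr
      _ = (((n + 1 : ℕ) : ℝ≥0∞)⁻¹ * w) * (2 * (lam : ℝ≥0∞) ^ 3 *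
            (lam : ℝ≥0∞) ^ (1 / p - 1) * w ^ (1 / p - 2) * Z) := by ring
      _ ≤ 2 * (2 * (lam : ℝ≥0∞) ^ 3 *
            (lam : ℝ≥0∞) ^ (1 / p - 1) * w ^ (1 / p - 2) * Z) := by gcongr
      _ = _ := by ring
  refine (ENNReal.rpow_le_rpow hdiv hp0.le).trans ?_
  rw [ENNReal.mul_rpow_of_nonneg _ _ hp0.le]
  refine mul_le_mul' le_rfl ?_
  have hsub : ∀ (s : Finset ℕ) (g : ℕ → ℝ≥0∞), (∑ i ∈ s, g i) ^ p ≤ ∑ i ∈ s, g i ^ p := by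
    intro s g
    induction s using Finset.induction_on with
    | empty => simp [hp0]
    | insert a s ha ih =>
      rw [sum_insert ha, sum_insert ha]
      exact (ENNReal.rpow_add_le_add_rpow _ _ hp0.le (by linarith)).trans (by gcongr)
  calc Z ^ p ≤ ∑ A ∈ range L, ∑ t ∈ range (A + 1),
        (M m A * M m t * localMass m μ p (mstar m f) t A x ^ (1 / p) : ℝ≥0∞) ^ p :=
        (hsub _ _).trans (sum_le_sum fun A _ => hsub _ _)
    _ = ∑ A ∈ range L, ∑ t ∈ range (A + 1),
          (M m A : ℝ≥0∞) ^ p * (M m t : ℝ≥0∞) ^ p * localMass m μ p (mstar m f) t A x := by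
        refine sum_congr rfl fun A _ => sum_congr rfl fun t _ => ?_
        rw [ENNReal.mul_rpow_of_nonneg _ _ hp0.le, ENNReal.mul_rpow_of_nonneg _ _ hp0.le,
          ← ENNReal.rpow_mul, one_div_mul_cancel hp0.ne', ENNReal.rpow_one]
    _ ≤ _ := ENNReal.sum_le_tsum _

lemma aemeasurable_indicator_cylExcept (hm : ∀ k, 2 ≤ m k) [SFinite μ] {g : Gm m → ℝ≥0∞}
    (hg : AEMeasurable g μ) (t A : ℕ) :
    AEMeasurable (Function.uncurry fun x y => (cylExcept m t A x).indicator g y) (μ.prod μ) := by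
  have h : AEMeasurable (fun z : Gm m × Gm m => g z.2) (μ.prod μ) :=
    hg.comp_quasiMeasurePreserving Measure.quasiMeasurePreserving_snd
  refine (h.indicator (measurableSet_cylExcept_prod hm t A)).congr
    (Filter.Eventually.of_forall fun z => ?_)
  simp [Set.indicator, Function.uncurry]

lemma localMass_eq (hm : ∀ k, 2 ≤ m k) (p : ℝ) (u : Gm m → ℝ≥0∞) (t A : ℕ) (x : Gm m) :
    localMass m μ p u t A x = ∫⁻ y, (cylExcept m t A x).indicator (fun y => u y ^ p) y ∂μ :=
  (lintegral_indicator (measurableSet_cylExcept hm t A x) _).symm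

lemma aemeasurable_localMass (hm : ∀ k, 2 ≤ m k) [SFinite μ] {p : ℝ} {u : Gm m → ℝ≥0∞}
    (hu : AEMeasurable u μ) (t A : ℕ) : AEMeasurable (localMass m μ p u t A) μ := by
  rw [show localMass m μ p u t A = _ from funext fun x => localMass_eq hm p u t A x]
  exact (aemeasurable_indicator_cylExcept hm (hu.pow_const p) t A).lintegral_prod_right'

lemma lintegral_localMass_le (hm : ∀ k, 2 ≤ m k) {lam : ℕ} (hlam : ∀ k, m k ≤ lam)
    (hμ : IsHaar m μ) {p : ℝ} {u : Gm m → ℝ≥0∞} (hu : AEMeasurable u μ) (t A : ℕ) :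
    ∫⁻ x, localMass m μ p u t A x ∂μ ≤ lam * (M m A : ℝ≥0∞)⁻¹ * ∫⁻ y, u y ^ p ∂μ := by
  have := hμ.isProbabilityMeasure
  simp_rw [localMass_eq hm]
  rw [lintegral_lintegral_swap (aemeasurable_indicator_cylExcept hm (hu.pow_const p) t A),
    ← lintegral_const_mul'' _ (hu.pow_const p)]
  refine lintegral_mono fun y => ?_
  have : (fun x => (cylExcept m t A x).indicator (fun y => u y ^ p) y) =
      (cylExcept m t A y).indicator fun _ => u y ^ p := by
    ext x
    by_cases h : y ∈ cylExcept m t A x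
    · rw [Set.indicator_of_mem h, Set.indicator_of_mem (mem_cylExcept_comm.1 h)]
    · rw [Set.indicator_of_notMem h,
        Set.indicator_of_notMem fun h' => h (mem_cylExcept_comm.1 h')]
  rw [this, lintegral_indicator_const (measurableSet_cylExcept hm t A y), mul_comm]
  gcongr
  exact measure_cylExcept_le hm hlam hμ t A y

lemma weight_le (hm : ∀ k, 2 ≤ m k) {p : ℝ} (hp0 : 0 < p) (hp1 : p < 1 / 2) {t A : ℕ}
    (h : t ≤ A) :
    (M m A : ℝ≥0∞) ^ p * (M m t : ℝ≥0∞) ^ p * (M m A : ℝ≥0∞)⁻¹ ≤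
      ENNReal.ofReal (((2 : ℝ) ^ (2 * p - 1)) ^ A) := by
  have hA0 : (M m A : ℝ≥0∞) ≠ 0 := by exact_mod_cast (M_pos hm A).ne'
  have hAt : (M m A : ℝ≥0∞) ≠ ⊤ := ENNReal.natCast_ne_top _
  calc (M m A : ℝ≥0∞) ^ p * (M m t : ℝ≥0∞) ^ p * (M m A : ℝ≥0∞)⁻¹
      ≤ (M m A : ℝ≥0∞) ^ p * (M m A : ℝ≥0∞) ^ p * (M m A : ℝ≥0∞)⁻¹ := by
        gcongr
        exact M_mono hm h
    _ = (M m A : ℝ≥0∞) ^ (2 * p - 1) := by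
        rw [← ENNReal.rpow_neg_one, ← ENNReal.rpow_add _ _ hA0 hAt, ← ENNReal.rpow_add _ _ hA0 hAt]
        ring_nf
    _ ≤ ((2 : ℝ≥0∞) ^ A) ^ (2 * p - 1) := by
        rw [← neg_neg (2 * p - 1), ENNReal.rpow_neg, ENNReal.rpow_neg _ (-(2 * p - 1)),
          ENNReal.inv_le_inv]
        refine ENNReal.rpow_le_rpow ?_ (by linarith)
        exact_mod_cast two_pow_le_M hm A
    _ = _ := by
        rw [ENNReal.ofReal_pow (by positivity), ← ENNReal.ofReal_rpow_of_pos two_pos,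
          ← ENNReal.rpow_natCast, ← ENNReal.rpow_natCast, ← ENNReal.rpow_mul, ← ENNReal.rpow_mul,
          mul_comm]
        simp

/-- The integrated form of the maximal inequality. -/
lemma lintegral_weighted_sigma_le (hm : ∀ k, 2 ≤ m k) {lam : ℕ} (hlam : ∀ k, m k ≤ lam)
    (hμ : IsHaar m μ) {f : ℕ → Gm m → ℂ} (hf : IsMartingale m μ f) {p : ℝ} (hp0 : 0 < p)
    (hp1 : p < 1 / 2) :
    ∫⁻ x, (⨆ n : ℕ, (‖sigma m μ f (n + 1) x‖₊ : ℝ≥0∞) /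
        ((n + 2 : ℕ) : ℝ≥0∞) ^ (1 / p - 2)) ^ p ∂μ ≤
      (4 * (lam : ℝ≥0∞) ^ 3 * (lam : ℝ≥0∞) ^ (1 / p - 1)) ^ p *
        (lam * ∑' A : ℕ, ENNReal.ofReal ((A + 1) * ((2 : ℝ) ^ (2 * p - 1)) ^ A)) *
          ∫⁻ x, mstar m f x ^ p ∂μ := by
  have := hμ.isProbabilityMeasure
  set C : ℝ≥0∞ := (4 * (lam : ℝ≥0∞) ^ 3 * (lam : ℝ≥0∞) ^ (1 / p - 1)) ^ p
  set J := ∫⁻ x, mstar m f x ^ p ∂μ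
  have hu : AEMeasurable (mstar m f) μ := by
    unfold mstar
    exact AEMeasurable.iSup fun n => (hf.integrable n).aemeasurable.enorm
  have hterm : ∀ A, AEMeasurable (fun x => ∑ t ∈ range (A + 1),
      (M m A : ℝ≥0∞) ^ p * (M m t : ℝ≥0∞) ^ p * localMass m μ p (mstar m f) t A x) μ := fun A =>
    Finset.aemeasurable_fun_sum _ fun t _ => (aemeasurable_localMass hm hu t A).const_mul _
  calc _ ≤ ∫⁻ x, C * ∑' A, ∑ t ∈ range (A + 1), (M m A : ℝ≥0∞) ^ p * (M m t : ℝ≥0∞) ^ p *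
        localMass m μ p (mstar m f) t A x ∂μ := by
        refine lintegral_mono fun x => ?_
        rw [← ENNReal.le_rpow_inv_iff hp0]
        refine iSup_le fun n => ?_
        rw [ENNReal.le_rpow_inv_iff hp0]
        exact weighted_sigma_le hm hlam hμ hf hp0 hp1 n x
    _ = C * ∑' A, ∑ t ∈ range (A + 1), (M m A : ℝ≥0∞) ^ p * (M m t : ℝ≥0∞) ^ p *
        ∫⁻ x, localMass m μ p (mstar m f) t A x ∂μ := by
        rw [lintegral_const_mul'' _ (AEMeasurable.tsum hterm), lintegral_tsum hterm]
        congr 2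
        ext A
        rw [lintegral_finsetSum' _ fun t _ => (aemeasurable_localMass hm hu t A).const_mul _]
        exact sum_congr rfl fun t _ => lintegral_const_mul'' _ (aemeasurable_localMass hm hu t A)
    _ ≤ C * ∑' A : ℕ, (lam * ENNReal.ofReal ((A + 1) * ((2 : ℝ) ^ (2 * p - 1)) ^ A)) * J := by
        refine mul_le_mul' le_rfl (ENNReal.tsum_le_tsum fun A => ?_)
        calc _ ≤ ∑ t ∈ range (A + 1),
              ENNReal.ofReal (((2 : ℝ) ^ (2 * p - 1)) ^ A) * (lam * J) := by
              refine sum_le_sum fun t ht => ?_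
              calc _ ≤ (M m A : ℝ≥0∞) ^ p * (M m t : ℝ≥0∞) ^ p *
                    (lam * (M m A : ℝ≥0∞)⁻¹ * J) := by
                    gcongr
                    exact lintegral_localMass_le hm hlam hμ hu t A
                _ = ((M m A : ℝ≥0∞) ^ p * (M m t : ℝ≥0∞) ^ p * (M m A : ℝ≥0∞)⁻¹) *
                    (lam * J) := by ring
                _ ≤ _ := by
                    gcongr
                    exact weight_le hm hp0 hp1 (by simpa [Nat.lt_succ_iff] using ht)
          _ = _ := by
              rw [sum_const, card_range, nsmul_eq_mul, ENNReal.ofReal_mul (by positivity)]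
              have : ENNReal.ofReal ((A : ℝ) + 1) = ((A + 1 : ℕ) : ℝ≥0∞) := by
                rw [← ENNReal.ofReal_natCast]; push_cast; rfl
              rw [this]
              ring
    _ = _ := by
        rw [ENNReal.tsum_mul_right, ENNReal.tsum_mul_left]
        ring

lemma tsum_weight_ne_top {p : ℝ} (hp1 : p < 1 / 2) :
    ∑' A : ℕ, ENNReal.ofReal ((A + 1) * ((2 : ℝ) ^ (2 * p - 1)) ^ A) ≠ ⊤ := by
  set r : ℝ := (2 : ℝ) ^ (2 * p - 1)
  have hr0 : 0 ≤ r := by positivity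
  have hr1 : r < 1 := Real.rpow_lt_one_of_one_lt_of_neg one_lt_two (by linarith)
  have hs : Summable fun A : ℕ => ((A : ℝ) + 1) * r ^ A := by
    have h1 := summable_pow_mul_geometric_of_norm_lt_one 1 (r := r)
      (by rwa [Real.norm_of_nonneg hr0])
    simpa [add_mul] using h1.add (summable_geometric_of_lt_one hr0 hr1)
  exact hs.tsum_ofReal_ne_top

end Estimates

end Vilenkin

/-- for `0 < p < 1/2` there is `c_p > 0` (depending only on `p` and
`λ = sup m_k`) with `‖ sup_{n ≥ 1} |σ_n f| / (n+1)^{1/p-2} ‖_{L_p} ≤ c_p ‖f‖_{H_p}`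
for every martingale `f ∈ H_p`. -/
theorem statement14 (p : ℝ) (hp0 : 0 < p) (hp1 : p < 1 / 2) (lam : ℕ) :
    ∃ c : ℝ, 0 < c ∧
      ∀ (m : ℕ → ℕ), (∀ k, 2 ≤ m k) → (∀ k, m k ≤ lam) →
      ∀ (μ : Measure (Gm m)), Vilenkin.IsHaar m μ →
      ∀ (f : ℕ → Gm m → ℂ), Vilenkin.IsMartingale m μ f → Vilenkin.MemHp m μ p f →
        Vilenkin.eLp m μ p (fun x => ⨆ n : ℕ,
            (‖Vilenkin.sigma m μ f (n + 1) x‖₊ : ℝ≥0∞) /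
              ((n + 2 : ℕ) : ℝ≥0∞) ^ (1 / p - 2)) ≤
          ENNReal.ofReal c * Vilenkin.eLp m μ p (Vilenkin.mstar m f) := by
  set W : ℝ≥0∞ := (4 * (lam : ℝ≥0∞) ^ 3 * (lam : ℝ≥0∞) ^ (1 / p - 1)) ^ p *
    (lam * ∑' A : ℕ, ENNReal.ofReal ((A + 1) * ((2 : ℝ) ^ (2 * p - 1)) ^ A)) with hW
  have hq : 0 ≤ 1 / p - 1 := by
    have := one_le_one_div hp0 (by linarith)
    linarith
  have hWt : W ^ (1 / p) ≠ ⊤ := by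
    refine ENNReal.rpow_ne_top_of_nonneg (by positivity) (ENNReal.mul_ne_top ?_ ?_)
    · refine ENNReal.rpow_ne_top_of_nonneg hp0.le (ENNReal.mul_ne_top ?_ ?_)
      · exact ENNReal.mul_ne_top (by norm_num) (ENNReal.pow_ne_top (ENNReal.natCast_ne_top _))
      · exact ENNReal.rpow_ne_top_of_nonneg hq (ENNReal.natCast_ne_top _)
    · exact ENNReal.mul_ne_top (ENNReal.natCast_ne_top _) (Vilenkin.tsum_weight_ne_top hp1)
  refine ⟨(W ^ (1 / p)).toReal + 1, by positivity, ?_⟩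
  intro m hm hlam μ hμ f hf _
  have hc : W ^ (1 / p) ≤ ENNReal.ofReal ((W ^ (1 / p)).toReal + 1) := by
    rw [← ENNReal.ofReal_toReal hWt, ENNReal.toReal_ofReal ENNReal.toReal_nonneg]
    exact ENNReal.ofReal_le_ofReal (by linarith)
  refine le_trans ?_ (mul_le_mul' hc le_rfl)
  rw [Vilenkin.eLp, Vilenkin.eLp, ← ENNReal.mul_rpow_of_nonneg _ _ (by positivity)]
  exact ENNReal.rpow_le_rpow (Vilenkin.lintegral_weighted_sigma_le hm hlam hμ hf hp0 hp1)
    (by positivity)
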